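/- arXiv:1511.08451 — 3 statements merged into one kernel-verified Lean document; each statement's English description precedes it below -/
import Mathlib

section
/- Let G be the 7 × 7 real symmetric matrix with all diagonal entries equal to 1 and off-diagonal entries (symmetrically extended) G₁₂ = −1, G₁₃ = −2√6/3, G₂₄ = −2√6/3, G₃₄ = −1/2, G₃₅ = −1/2, G₄₇ = −1/2, G₅₆ = −1/2, G₆₇ = −1/2, G₅₇ = −1/2, and all other off-diagonal entries 0. Then G has exactly 4 positive eigenvalues (with multiplicity), exactly 1 negative eigenvalue, and exactly 2 zero eigenvalues; equivalently G has rank 5 and signature (4,1). -/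
open Real

noncomputable def G6 : Matrix (Fin 7) (Fin 7) ℝ :=
  !![1, -1, -(2 * Real.sqrt 6 / 3), 0, 0, 0, 0;
     -1, 1, 0, -(2 * Real.sqrt 6 / 3), 0, 0, 0;
     -(2 * Real.sqrt 6 / 3), 0, 1, -(1/2), -(1/2), 0, 0;
     0, -(2 * Real.sqrt 6 / 3), -(1/2), 1, 0, 0, -(1/2);
     0, 0, -(1/2), 0, 1, -(1/2), -(1/2);
     0, 0, 0, 0, -(1/2), 1, -(1/2);
     0, 0, 0, -(1/2), -(1/2), -(1/2), 1]

namespace Matrix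

open QuadraticMap

variable {n : Type*} [Fintype n] [DecidableEq n]

theorem toQuadraticForm'_equivalent_weightedSumSquares {A P : Matrix n n ℝ} {w : n → ℝ}
    (hP : IsUnit P) (hA : A = Pᵀ * diagonal w * P) :
    A.toQuadraticForm'.Equivalent (weightedSumSquares ℝ w) := by
  refine ⟨⟨LinearEquiv.ofBijective P.mulVecLin
    ⟨mulVec_injective_iff_isUnit.2 hP, mulVec_surjective_iff_isUnit.2 hP⟩, fun x => ?_⟩⟩
  have h : A.toQuadraticForm' x = x ⬝ᵥ (A *ᵥ x) := by
    simp [toQuadraticForm', LinearMap.BilinMap.toQuadraticMap_apply, toLinearMap₂'_apply']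
  have h' : x ⬝ᵥ (A *ᵥ x) = (P *ᵥ x) ⬝ᵥ (diagonal w *ᵥ (P *ᵥ x)) := by
    rw [hA, ← mulVec_mulVec, ← mulVec_mulVec, dotProduct_mulVec, vecMul_transpose]
  change weightedSumSquares ℝ w (P *ᵥ x) = A.toQuadraticForm' x
  rw [h, h', weightedSumSquares_apply]
  simp only [dotProduct, mulVec_diagonal, smul_eq_mul]
  exact Finset.sum_congr rfl fun i _ => by ring

theorem IsHermitian.toQuadraticForm'_equivalent_eigenvalues {A : Matrix n n ℝ}
    (hA : A.IsHermitian) :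
    A.toQuadraticForm'.Equivalent (weightedSumSquares ℝ hA.eigenvalues) := by
  refine toQuadraticForm'_equivalent_weightedSumSquares
    (P := star (hA.eigenvectorUnitary : Matrix n n ℝ))
    (Unitary.toUnits (star hA.eigenvectorUnitary)).isUnit ?_
  have h := hA.spectral_theorem
  rw [Unitary.conjStarAlgAut_apply] at h
  simpa [star_eq_conjTranspose, Function.comp_def] using h

/-- **Sylvester's law of inertia** for the positive eigenvalues. -/
theorem IsHermitian.card_eigenvalues_pos {A P : Matrix n n ℝ} {w : n → ℝ}
    (hA : A.IsHermitian) (hP : IsUnit P) (h : A = Pᵀ * diagonal w * P) :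
    (Finset.univ.filter fun j => 0 < hA.eigenvalues j).card =
      (Finset.univ.filter fun j => 0 < w j).card := by
  have h₁ := hA.toQuadraticForm'_equivalent_eigenvalues.sigPos_eq
  rw [(toQuadraticForm'_equivalent_weightedSumSquares hP h).sigPos_eq,
    QuadraticForm.sigPos_weightedSumSquares, QuadraticForm.sigPos_weightedSumSquares] at h₁
  simpa [Set.ncard_eq_toFinset_card'] using h₁.symm

/-- **Sylvester's law of inertia** for the negative eigenvalues. -/
theorem IsHermitian.card_eigenvalues_neg {A P : Matrix n n ℝ} {w : n → ℝ}
    (hA : A.IsHermitian) (hP : IsUnit P) (h : A = Pᵀ * diagonal w * P) :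
    (Finset.univ.filter fun j => hA.eigenvalues j < 0).card =
      (Finset.univ.filter fun j => w j < 0).card := by
  have h₁ := hA.toQuadraticForm'_equivalent_eigenvalues.sigNeg_eq
  rw [(toQuadraticForm'_equivalent_weightedSumSquares hP h).sigNeg_eq,
    QuadraticForm.sigNeg_weightedSumSquares, QuadraticForm.sigNeg_weightedSumSquares] at h₁
  simpa [Set.ncard_eq_toFinset_card'] using h₁.symm

end Matrix

open Matrix

/-- The linear forms diagonalizing `G6`, completed to a basis by two coordinate forms. -/
noncomputable def G6Forms : Matrix (Fin 7) (Fin 7) ℝ :=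
  !![1, -1, -(2 * √6 / 3), 0, 0, 0, 0;
     0, 0, 0, 0, -(1/2), 1, -(1/2);
     0, 0, -(2/3), 0, 1, 0, -1;
     0, -(4 * √6 / 3), -1, 2, 0, 0, -1;
     0, 4 * √6 / 3, 3, 0, 0, 0, 1;
     0, 0, 0, 0, 0, 0, 1;
     0, 0, 1, 0, 0, 0, 0]

/-- The coefficients of `G6` with respect to `G6Forms`. -/
noncomputable def G6Weights : Fin 7 → ℝ := ![1, 1, 3/4, 1/4, -(1/4), 0, 0]

theorem isUnit_G6Forms : IsUnit G6Forms := by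
  rw [← mulVec_injective_iff_isUnit, ← coe_mulVecLin, injective_iff_map_eq_zero]
  intro x hx
  have h i := congrFun hx i
  have h0 := h 0
  have h1 := h 1
  have h2 := h 2
  have h3 := h 3
  have h4 := h 4
  have h5 := h 5
  have h6 := h 6
  simp [G6Forms, mulVec, dotProduct, Fin.sum_univ_seven] at h0 h1 h2 h3 h4 h5 h6
  have hx1 : x 1 = 0 := by simpa [h5, h6] using h4
  simp only [h5, h6, hx1] at h0 h1 h2 h3
  ext i
  fin_cases i <;> simp <;> linarith

theorem G6_eq_transpose_mul_diagonal_mul :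
    G6 = G6Formsᵀ * diagonal G6Weights * G6Forms := by
  have h6 : √6 ^ 2 = 6 := Real.sq_sqrt (by norm_num)
  ext i j
  rw [mul_apply]
  simp only [mul_diagonal, transpose_apply, Fin.sum_univ_seven]
  fin_cases i <;> fin_cases j <;> simp [G6, G6Forms, G6Weights] <;> linarith

theorem stmt_6 (hG : G6.IsHermitian) :
    (Finset.univ.filter fun j => 0 < hG.eigenvalues j).card = 4 ∧
    (Finset.univ.filter fun j => hG.eigenvalues j < 0).card = 1 ∧
    (Finset.univ.filter fun j => hG.eigenvalues j = 0).card = 2 ∧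
    G6.rank = 5 := by
  have hpos : (Finset.univ.filter fun j => 0 < hG.eigenvalues j).card = 4 := by
    rw [hG.card_eigenvalues_pos isUnit_G6Forms G6_eq_transpose_mul_diagonal_mul,
      Finset.card_filter, Fin.sum_univ_seven]
    simp [G6Weights]
  have hneg : (Finset.univ.filter fun j => hG.eigenvalues j < 0).card = 1 := by
    rw [hG.card_eigenvalues_neg isUnit_G6Forms G6_eq_transpose_mul_diagonal_mul,
      Finset.card_filter, Fin.sum_univ_seven]
    simp [G6Weights]
    norm_num
  have hne : (Finset.univ.filter fun j => hG.eigenvalues j ≠ 0).card = 5 := by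
    have h : (Finset.univ.filter fun j => hG.eigenvalues j ≠ 0) =
        (Finset.univ.filter fun j => 0 < hG.eigenvalues j) ∪
          (Finset.univ.filter fun j => hG.eigenvalues j < 0) := by
      ext j
      simp only [Finset.mem_filter_univ, Finset.mem_union]
      exact ne_iff_gt_or_lt
    rw [h, Finset.card_union_of_disjoint, hpos, hneg]
    exact Finset.disjoint_filter.2 fun j _ h₁ h₂ => h₁.asymm h₂
  refine ⟨hpos, hneg, ?_, ?_⟩
  · have h := Finset.card_filter_add_card_filter_not (s := Finset.univ)
      (fun j => hG.eigenvalues j = 0)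
    simp only [Finset.card_univ, Fintype.card_fin] at h
    simp only [ne_eq] at hne
    omega
  · rw [hG.rank_eq_card_non_zero_eigs, Fintype.card_subtype, hne]
end

section
/- Let G be the 10 × 10 real symmetric matrix with all diagonal entries equal to 1 and off-diagonal entries (symmetrically extended) G₁₂ = −1, G₁₃ = −2√3/3, G₂₄ = −2√3/3, G₃₅ = −1/2, G₅₉ = −1/2, G₅₆ = −1/2, G₆₇ = −1/2, G₇₈ = −1/2, G₉,₁₀ = −1/2, G₈,₁₀ = −1/2, G₄,₁₀ = −1/2, and all other off-diagonal entries 0. Then G has exactly 7 positive eigenvalues (with multiplicity), exactly 1 negative eigenvalue, and exactly 2 zero eigenvalues; equivalently G has rank 8 and signature (7,1). -/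
open Real

noncomputable def G14 : Matrix (Fin 10) (Fin 10) ℝ :=
  !![1, -1, -(2 * Real.sqrt 3 / 3), 0, 0, 0, 0, 0, 0, 0;
     -1, 1, 0, -(2 * Real.sqrt 3 / 3), 0, 0, 0, 0, 0, 0;
     -(2 * Real.sqrt 3 / 3), 0, 1, 0, -(1/2), 0, 0, 0, 0, 0;
     0, -(2 * Real.sqrt 3 / 3), 0, 1, 0, 0, 0, 0, 0, -(1/2);
     0, 0, -(1/2), 0, 1, -(1/2), 0, 0, -(1/2), 0;
     0, 0, 0, 0, -(1/2), 1, -(1/2), 0, 0, 0;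
     0, 0, 0, 0, 0, -(1/2), 1, -(1/2), 0, 0;
     0, 0, 0, 0, 0, 0, -(1/2), 1, 0, -(1/2);
     0, 0, 0, 0, -(1/2), 0, 0, 0, 1, -(1/2);
     0, 0, 0, -(1/2), 0, 0, 0, -(1/2), -(1/2), 1]

open Matrix QuadraticMap QuadraticForm

section Inertia

variable {n : Type*} [Fintype n] [DecidableEq n]

/-- A congruence `A = Pᵀ D P` with `P` invertible identifies the quadratic form of `A` with the
weighted sum of squares given by the diagonal matrix `D`. -/
theorem equivalent_weightedSumSquares_of_congruent {A P : Matrix n n ℝ} {d : n → ℝ}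
    (hP : IsUnit P) (h : A = Pᵀ * diagonal d * P) :
    A.toQuadraticForm'.Equivalent (weightedSumSquares ℝ d) := by
  have := hP.invertible
  refine ⟨⟨P.toLinearEquiv' this, fun x => ?_⟩⟩
  rw [weightedSumSquares_apply]
  change _ = toLinearMap₂' ℝ A x x
  rw [toLinearMap₂'_apply', h, ← mulVec_mulVec, ← mulVec_mulVec, dotProduct_mulVec,
    vecMul_transpose]
  change ∑ i, d i * ((P *ᵥ x) i * (P *ᵥ x) i) = _
  simp only [dotProduct, mulVec_diagonal]
  exact Finset.sum_congr rfl fun i _ => by ring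

theorem equivalent_weightedSumSquares_eigenvalues {A : Matrix n n ℝ} (hA : A.IsHermitian) :
    A.toQuadraticForm'.Equivalent (weightedSumSquares ℝ hA.eigenvalues) := by
  refine equivalent_weightedSumSquares_of_congruent
    (P := star (hA.eigenvectorUnitary : Matrix n n ℝ)) ?_ ?_
  · exact (Unitary.toUnits (star hA.eigenvectorUnitary)).isUnit
  · conv_lhs => rw [hA.spectral_theorem, Unitary.conjStarAlgAut_apply]
    simp [star_eq_conjTranspose]

/-- **Sylvester's law of inertia** for the positive eigenvalues of a real symmetric matrix. -/
theorem card_eigenvalues_pos_of_congruent {A P : Matrix n n ℝ} {d : n → ℝ}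
    (hA : A.IsHermitian) (hP : IsUnit P) (h : A = Pᵀ * diagonal d * P) :
    (Finset.univ.filter fun j => 0 < hA.eigenvalues j).card =
      (Finset.univ.filter fun j => 0 < d j).card := by
  have := (sigPos_of_equiv_weightedSumSquares
    (equivalent_weightedSumSquares_eigenvalues hA)).symm.trans
      (sigPos_of_equiv_weightedSumSquares (equivalent_weightedSumSquares_of_congruent hP h))
  simpa only [Set.ncard_eq_toFinset_card', Set.toFinset_ofPred] using this

/-- **Sylvester's law of inertia** for the negative eigenvalues of a real symmetric matrix. -/
theorem card_eigenvalues_neg_of_congruent {A P : Matrix n n ℝ} {d : n → ℝ}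
    (hA : A.IsHermitian) (hP : IsUnit P) (h : A = Pᵀ * diagonal d * P) :
    (Finset.univ.filter fun j => hA.eigenvalues j < 0).card =
      (Finset.univ.filter fun j => d j < 0).card := by
  have := (sigNeg_of_equiv_weightedSumSquares
    (equivalent_weightedSumSquares_eigenvalues hA)).symm.trans
      (sigNeg_of_equiv_weightedSumSquares (equivalent_weightedSumSquares_of_congruent hP h))
  simpa only [Set.ncard_eq_toFinset_card', Set.toFinset_ofPred] using this

end Inertia

/-- The change of coordinates produced by Gaussian elimination on `G14`, starting from the last
coordinate. -/
noncomputable def G14.congruence : Matrix (Fin 10) (Fin 10) ℝ :=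
  !![1, 0, 0, 0, 0, 0, 0, 0, 0, 0;
     0, 1, 0, 0, 0, 0, 0, 0, 0, 0;
     -(√3 / 2), √3 / 2, 1, 0, 0, 0, 0, 0, 0, 0;
     0, -(2 * √3), 0, 1, -(3/2), 0, 0, 0, 0, 0;
     0, 4 * √3 / 3, 2/3, 0, 1, 0, 0, 0, 0, 0;
     0, 0, 0, -(1/3), -1, 1, 0, 0, 0, 0;
     0, 0, 0, -(2/5), -(1/5), -(4/5), 1, 0, 0, 0;
     0, 0, 0, -(1/2), -(1/4), 0, -(3/4), 1, 0, 0;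
     0, 0, 0, -(1/3), -(2/3), 0, 0, -(1/3), 1, 0;
     0, 0, 0, -(1/2), 0, 0, 0, -(1/2), -(1/2), 1]

/-- The pivots of the Gaussian elimination on `G14`. -/
noncomputable def G14.pivots : Fin 10 → ℝ :=
  ![0, 0, 4/3, 1/3, -(3/4), 3/5, 5/8, 2/3, 3/4, 1]

theorem G14.isUnit_congruence : IsUnit G14.congruence := by
  rw [← mulVec_injective_iff_isUnit]
  refine (injective_iff_map_eq_zero G14.congruence.mulVecLin).2 fun x hx => ?_
  have key : ∀ i, (G14.congruence *ᵥ x) i = 0 := fun i => congrFun hx i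
  simp [Fin.forall_fin_succ, G14.congruence, mulVec, dotProduct, Fin.sum_univ_succ] at key
  obtain ⟨h0, h1, h2, h3, h4, h5, h6, h7, h8, h9⟩ := key
  simp only [h0, h1, mul_zero, neg_zero, zero_add] at h2 h3 h4
  have x4 : x 4 = 0 := by linarith
  have x3 : x 3 = 0 := by linarith
  have x5 : x 5 = 0 := by linarith
  have x6 : x 6 = 0 := by linarith
  have x7 : x 7 = 0 := by linarith
  have x8 : x 8 = 0 := by linarith
  have x9 : x 9 = 0 := by linarith
  ext i
  fin_cases i <;> assumption

set_option maxHeartbeats 2000000 in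
theorem G14.eq_congruence :
    G14 = G14.congruenceᵀ * diagonal G14.pivots * G14.congruence := by
  have h3 : √3 * √3 = 3 := Real.mul_self_sqrt (by norm_num)
  ext i j
  rw [mul_apply]
  simp only [mul_diagonal, transpose_apply]
  fin_cases i <;> fin_cases j <;>
    simp [G14, G14.congruence, G14.pivots, Fin.sum_univ_succ] <;> linarith

theorem stmt_14 (hG : G14.IsHermitian) :
    (Finset.univ.filter fun j => 0 < hG.eigenvalues j).card = 7 ∧
    (Finset.univ.filter fun j => hG.eigenvalues j < 0).card = 1 ∧
    (Finset.univ.filter fun j => hG.eigenvalues j = 0).card = 2 ∧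
    G14.rank = 8 := by
  have hpos : (Finset.univ.filter fun j => 0 < hG.eigenvalues j).card = 7 := by
    rw [card_eigenvalues_pos_of_congruent hG G14.isUnit_congruence G14.eq_congruence,
      Finset.card_filter]
    norm_num [Fin.sum_univ_succ, G14.pivots, -Finset.sum_boole]
  have hneg : (Finset.univ.filter fun j => hG.eigenvalues j < 0).card = 1 := by
    rw [card_eigenvalues_neg_of_congruent hG G14.isUnit_congruence G14.eq_congruence,
      Finset.card_filter]
    norm_num [Fin.sum_univ_succ, G14.pivots, -Finset.sum_boole]
  have hne : (Finset.univ.filter fun j => hG.eigenvalues j ≠ 0).card = 8 := by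
    simp only [ne_iff_lt_or_gt, Finset.filter_or]
    rw [Finset.card_union_of_disjoint, hneg, hpos]
    exact Finset.disjoint_filter.2 fun _ _ h => h.not_gt
  have hzero := Finset.card_filter_add_card_filter_not (s := Finset.univ)
    fun j => hG.eigenvalues j = 0
  rw [hne, Finset.card_univ, Fintype.card_fin] at hzero
  refine ⟨hpos, hneg, by lia, ?_⟩
  rw [hG.rank_eq_card_non_zero_eigs, Fintype.card_subtype, hne]
end

section
/- Let G be the 11 × 11 real symmetric matrix with all diagonal entries equal to 1 and off-diagonal entries (symmetrically extended) G₁₂ = −1, G₁₃ = −2√3/3, G₂₄ = −2√3/3, G₃₅ = −1/2, G₅₆ = −1/2, G₆₇ = −1/2, G₇₈ = −1/2, G₈₉ = −1/2, G₇,₁₀ = −1/2, G₁₀,₁₁ = −1/2, G₄,₁₁ = −1/2, and all other off-diagonal entries 0. Then G has exactly 8 positive eigenvalues (with multiplicity), exactly 1 negative eigenvalue, and exactly 2 zero eigenvalues; equivalently G has rank 9 and signature (8,1). -/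
open Real

noncomputable def G16 : Matrix (Fin 11) (Fin 11) ℝ :=
  !![1, -1, -(2 * Real.sqrt 3 / 3), 0, 0, 0, 0, 0, 0, 0, 0;
     -1, 1, 0, -(2 * Real.sqrt 3 / 3), 0, 0, 0, 0, 0, 0, 0;
     -(2 * Real.sqrt 3 / 3), 0, 1, 0, -(1/2), 0, 0, 0, 0, 0, 0;
     0, -(2 * Real.sqrt 3 / 3), 0, 1, 0, 0, 0, 0, 0, 0, -(1/2);
     0, 0, -(1/2), 0, 1, -(1/2), 0, 0, 0, 0, 0;
     0, 0, 0, 0, -(1/2), 1, -(1/2), 0, 0, 0, 0;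
     0, 0, 0, 0, 0, -(1/2), 1, -(1/2), 0, -(1/2), 0;
     0, 0, 0, 0, 0, 0, -(1/2), 1, -(1/2), 0, 0;
     0, 0, 0, 0, 0, 0, 0, -(1/2), 1, 0, 0;
     0, 0, 0, 0, 0, 0, -(1/2), 0, 0, 1, -(1/2);
     0, 0, 0, -(1/2), 0, 0, 0, 0, 0, -(1/2), 1]

theorem weightedSumSquares_mulVec {n : Type*} [Fintype n] [DecidableEq n]
    (P : Matrix n n ℝ) (w x : n → ℝ) :
    QuadraticMap.weightedSumSquares ℝ w (P.mulVec x) =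
      x ⬝ᵥ (P.transpose * Matrix.diagonal w * P).mulVec x := by
  rw [QuadraticMap.weightedSumSquares_apply, ← Matrix.mulVec_mulVec, ← Matrix.mulVec_mulVec,
    Matrix.dotProduct_mulVec, Matrix.vecMul_transpose]
  simp only [dotProduct, Matrix.mulVec_diagonal, smul_eq_mul]
  exact Finset.sum_congr rfl fun i _ => by ring

theorem weightedSumSquares_equivalent_of_congruent {n : Type*} [Fintype n] [DecidableEq n]
    {P Q : Matrix n n ℝ} (hP : IsUnit P) (hQ : IsUnit Q) {w u : n → ℝ}
    (h : P.transpose * Matrix.diagonal w * P = Q.transpose * Matrix.diagonal u * Q) :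
    (QuadraticMap.weightedSumSquares ℝ w).Equivalent
      (QuadraticMap.weightedSumSquares ℝ u) := by
  have key (R : Matrix n n ℝ) (hR : IsUnit R) (v : n → ℝ) :
      ((QuadraticMap.weightedSumSquares ℝ v).comp R.mulVecLin).Equivalent
        (QuadraticMap.weightedSumSquares ℝ v) :=
    ⟨{ LinearEquiv.ofInjectiveEndo R.mulVecLin (Matrix.mulVec_injective_iff_isUnit.2 hR) with
        map_app' := fun _ => rfl }⟩
  have e : (QuadraticMap.weightedSumSquares ℝ w).comp P.mulVecLin =
      (QuadraticMap.weightedSumSquares ℝ u).comp Q.mulVecLin := by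
    ext x
    simp only [QuadraticMap.comp_apply, Matrix.mulVecLin_apply, weightedSumSquares_mulVec, h]
  exact (key P hP w).symm.trans (e ▸ key Q hQ u)

/-- **Sylvester's law of inertia** for the eigenvalues of a real symmetric matrix. -/
theorem card_eigenvalues_of_eq_transpose_mul_diagonal_mul {n : Type*} [Fintype n] [DecidableEq n]
    {A P : Matrix n n ℝ} (hA : A.IsHermitian) (hP : IsUnit P) {w : n → ℝ}
    (h : A = P.transpose * Matrix.diagonal w * P) :
    (Finset.univ.filter fun j => 0 < hA.eigenvalues j).card =
        (Finset.univ.filter fun j => 0 < w j).card ∧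
      (Finset.univ.filter fun j => hA.eigenvalues j < 0).card =
        (Finset.univ.filter fun j => w j < 0).card := by
  set U := hA.eigenvectorUnitary
  have hU : IsUnit (star (U : Matrix n n ℝ)) := (Unitary.toUnits (star U)).isUnit
  have hspec : A = (star (U : Matrix n n ℝ)).transpose * Matrix.diagonal hA.eigenvalues *
      star (U : Matrix n n ℝ) := by
    conv_lhs => rw [hA.spectral_theorem, Unitary.conjStarAlgAut_apply]
    congr 2
  have e := weightedSumSquares_equivalent_of_congruent hU hP (hspec.symm.trans h)
  have hpos := e.sigPos_eq
  have hneg := e.sigNeg_eq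
  simp only [QuadraticForm.sigPos_weightedSumSquares] at hpos
  simp only [QuadraticForm.sigNeg_weightedSumSquares] at hneg
  constructor
  · simpa [Set.ncard_eq_toFinset_card'] using hpos
  · simpa [Set.ncard_eq_toFinset_card'] using hneg

/-- The weights of a diagonalization of `G16` by congruence, see `G16_eq`. -/
noncomputable def G16Weights : Fin 11 → ℝ :=
  ![0, 0, 4/3, 1/3, -(3/4), 1/4, 1/3, 3/4, 1, 3/4, 1]

/-- The change of coordinates in a diagonalization of `G16` by congruence, see `G16_eq`. -/
noncomputable def G16Coords : Matrix (Fin 11) (Fin 11) ℝ :=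
  !![1, 0, 0, 0, 0, 0, 0, 0, 0, 0, 0;
     0, 1, 0, 0, 0, 0, 0, 0, 0, 0, 0;
     -(√3 / 2), √3 / 2, 1, 0, 0, 0, 0, 0, 0, 0, 0;
     0, -(2 * √3), 0, 1, -(3/2), 0, 0, 0, 0, 0, 0;
     0, 4 * √3 / 3, 2/3, 0, 1, 0, 0, 0, 0, 0, 0;
     0, 0, 0, -1, -2, 1, 0, 0, 0, 0, 0;
     0, 0, 0, -(1/2), 0, -(3/2), 1, 0, 0, 0, 0;
     0, 0, 0, 0, 0, 0, -(2/3), 1, 0, 0, 0;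
     0, 0, 0, 0, 0, 0, 0, -(1/2), 1, 0, 0;
     0, 0, 0, -(1/3), 0, 0, -(2/3), 0, 0, 1, 0;
     0, 0, 0, -(1/2), 0, 0, 0, 0, 0, -(1/2), 1]

theorem isUnit_G16Coords : IsUnit G16Coords := by
  rw [← Matrix.mulVec_injective_iff_isUnit]
  refine (injective_iff_map_eq_zero G16Coords.mulVecLin).2 fun v hv => ?_
  have hrow (i : Fin 11) : ∑ j, G16Coords i j * v j = 0 := congrFun hv i
  have h0 : v 0 = 0 := by simpa [G16Coords, Fin.sum_univ_succ] using hrow 0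
  have h1 : v 1 = 0 := by simpa [G16Coords, Fin.sum_univ_succ] using hrow 1
  have h2 : v 2 = 0 := by simpa [G16Coords, Fin.sum_univ_succ, h0, h1] using hrow 2
  have h4 : v 4 = 0 := by simpa [G16Coords, Fin.sum_univ_succ, h1, h2] using hrow 4
  have h3 : v 3 = 0 := by simpa [G16Coords, Fin.sum_univ_succ, h1, h4] using hrow 3
  have h5 : v 5 = 0 := by simpa [G16Coords, Fin.sum_univ_succ, h3, h4] using hrow 5
  have h6 : v 6 = 0 := by simpa [G16Coords, Fin.sum_univ_succ, h3, h5] using hrow 6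
  have h7 : v 7 = 0 := by simpa [G16Coords, Fin.sum_univ_succ, h6] using hrow 7
  have h8 : v 8 = 0 := by simpa [G16Coords, Fin.sum_univ_succ, h7] using hrow 8
  have h9 : v 9 = 0 := by simpa [G16Coords, Fin.sum_univ_succ, h3, h6] using hrow 9
  have h10 : v 10 = 0 := by simpa [G16Coords, Fin.sum_univ_succ, h3, h9] using hrow 10
  ext i
  fin_cases i <;> assumption

set_option maxHeartbeats 1000000 in
theorem G16_eq : G16 = G16Coords.transpose * Matrix.diagonal G16Weights * G16Coords := by
  have h3 : √3 ^ 2 = (3 : ℝ) := Real.sq_sqrt (by norm_num)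
  ext i j
  rw [Matrix.mul_apply]
  simp only [Matrix.mul_diagonal, Matrix.transpose_apply]
  fin_cases i <;> fin_cases j <;>
    simp [G16, G16Coords, G16Weights, Fin.sum_univ_succ] <;> grind

theorem stmt_16 (hG : G16.IsHermitian) :
    (Finset.univ.filter fun j => 0 < hG.eigenvalues j).card = 8 ∧
    (Finset.univ.filter fun j => hG.eigenvalues j < 0).card = 1 ∧
    (Finset.univ.filter fun j => hG.eigenvalues j = 0).card = 2 ∧
    G16.rank = 9 := by
  obtain ⟨hpos, hneg⟩ :=
    card_eigenvalues_of_eq_transpose_mul_diagonal_mul hG isUnit_G16Coords G16_eq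
  have hwpos : (Finset.univ.filter fun j => 0 < G16Weights j) = {2, 3, 5, 6, 7, 8, 9, 10} := by
    ext j
    fin_cases j <;> simp [G16Weights]
    positivity
  have hwneg : (Finset.univ.filter fun j => G16Weights j < 0) = {4} := by
    ext j
    fin_cases j <;> simp [G16Weights] <;> positivity
  replace hpos := hpos.trans ((congrArg Finset.card hwpos).trans (by rfl : _ = 8))
  replace hneg := hneg.trans ((congrArg Finset.card hwneg).trans (Finset.card_singleton 4))
  have hne : (Finset.univ.filter fun j => hG.eigenvalues j ≠ 0).card = 9 := by
    have hunion : (Finset.univ.filter fun j => hG.eigenvalues j ≠ 0) =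
        (Finset.univ.filter fun j => 0 < hG.eigenvalues j) ∪
          Finset.univ.filter fun j => hG.eigenvalues j < 0 := by
      ext j
      simp [lt_or_lt_iff_ne, eq_comm]
    rw [hunion, Finset.card_union_of_disjoint, hpos, hneg]
    exact Finset.disjoint_filter.2 fun _ _ => lt_asymm
  have hsum := Finset.card_filter_add_card_filter_not (s := Finset.univ)
    fun j => hG.eigenvalues j = 0
  rw [Finset.card_univ, Fintype.card_fin] at hsum
  refine ⟨hpos, hneg, by simp only [ne_eq] at hne; omega, ?_⟩
  rw [hG.rank_eq_card_non_zero_eigs, Fintype.card_subtype, hne]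
end
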